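/- arXiv:1607.06557 — 4 statements merged into one kernel-verified Lean document; each statement's English description precedes it below -/
import Mathlib

section
/- Let α > 0 and ε > 0. For every λ ∈ [exp(−α²/(2ε)), 1] (indeed for every λ ∈ (0,1]), the function E_ε satisfies E_ε(λ) = (α² − 2ε)λ² + 2ελ³ + R_ε(λ) where the remainder R_ε(λ) = −2ελ²(λ − 1 − ln λ) obeys |R_ε(λ)| ≤ ε. -/
/-- On `(0, 1]` the function `x² (x - 1 - log x)` is at most `x (1 - x)²`, hence at most `1 / 2`. -/
theorem sq_mul_sub_one_sub_log_le_half {x : ℝ} (hx0 : 0 < x) (hx1 : x ≤ 1) :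
    x ^ 2 * (x - 1 - Real.log x) ≤ 1 / 2 := by
  have hlog : 1 - x⁻¹ ≤ Real.log x := Real.one_sub_inv_le_log_of_pos hx0
  calc x ^ 2 * (x - 1 - Real.log x) ≤ x ^ 2 * (x - 1 - (1 - x⁻¹)) := by gcongr
    _ = x * (1 - x) * (1 - x) := by field_simp; ring
    _ ≤ 1 / 2 := by nlinarith [sq_nonneg (x - 1 / 2), mul_nonneg hx0.le (sub_nonneg.2 hx1)]

/-- The Taylor-type asymptotic expansion of `E_ε(λ) = λ²(α² + 2ε ln λ)`:
for every `λ ∈ (0,1]` one has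
`E_ε(λ) = (α² − 2ε)λ² + 2ελ³ + R_ε(λ)` with
`R_ε(λ) = −2ελ²(λ − 1 − ln λ)` and `|R_ε(λ)| ≤ ε`. -/
theorem stmt_0 (α ε : ℝ) (hα : 0 < α) (hε : 0 < ε)
    (lam : ℝ) (hlam0 : 0 < lam) (hlam1 : lam ≤ 1) :
    lam ^ 2 * (α ^ 2 + 2 * ε * Real.log lam) =
      (α ^ 2 - 2 * ε) * lam ^ 2 + 2 * ε * lam ^ 3 +
        (-(2 * ε * lam ^ 2 * (lam - 1 - Real.log lam))) ∧
    |(-(2 * ε * lam ^ 2 * (lam - 1 - Real.log lam)))| ≤ ε := by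
  refine ⟨by ring, ?_⟩
  have hnonneg : 0 ≤ lam - 1 - Real.log lam := by
    linarith [Real.log_le_sub_one_of_pos hlam0]
  rw [abs_neg, abs_of_nonneg (by positivity)]
  calc 2 * ε * lam ^ 2 * (lam - 1 - Real.log lam)
      = 2 * ε * (lam ^ 2 * (lam - 1 - Real.log lam)) := by ring
    _ ≤ 2 * ε * (1 / 2) := by
      gcongr
      exact sq_mul_sub_one_sub_log_le_half hlam0 hlam1
    _ = ε := by ring
end

section
/- Let α > 0, ε > 0 and c > 0. The function h(x) = x / E_ε^{-1}(c x²) is strictly increasing on the set {x ∈ ℝ : c x² ≤ α²}. -/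
open Set

/-- `E_ε(x) = x²(α² + 2ε ln x)`. -/
noncomputable def Eeps (α ε : ℝ) (x : ℝ) : ℝ := x ^ 2 * (α ^ 2 + 2 * ε * Real.log x)

/-- `E_ε⁻¹ : [0, α²] → [exp(−α²/(2ε)), 1]`, the inverse of the strictly
increasing bijection `E_ε` from `[exp(−α²/(2ε)), 1]` onto `[0, α²]`. -/
noncomputable def EepsInv (α ε : ℝ) (t : ℝ) : ℝ :=
  Function.invFunOn (Eeps α ε) (Set.Icc (Real.exp (-α ^ 2 / (2 * ε))) 1) t

theorem Eeps_factor_nonneg {α ε y : ℝ} (hε : 0 < ε)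
    (hy : Real.exp (-α ^ 2 / (2 * ε)) ≤ y) : 0 ≤ α ^ 2 + 2 * ε * Real.log y := by
  have h := (Real.le_log_iff_exp_le ((Real.exp_pos _).trans_le hy)).2 hy
  rw [div_le_iff₀ (by positivity)] at h
  linarith

theorem surjOn_Eeps {α ε : ℝ} (hε : 0 < ε) :
    Set.SurjOn (Eeps α ε) (Set.Icc (Real.exp (-α ^ 2 / (2 * ε))) 1) (Set.Icc 0 (α ^ 2)) := by
  have hle : Real.exp (-α ^ 2 / (2 * ε)) ≤ 1 :=
    Real.exp_le_one_iff.2 (div_nonpos_of_nonpos_of_nonneg (by nlinarith [sq_nonneg α])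
      (by positivity))
  have hcont : ContinuousOn (Eeps α ε) (Set.Icc (Real.exp (-α ^ 2 / (2 * ε))) 1) := by
    unfold Eeps
    refine (continuousOn_id.pow 2).mul (continuousOn_const.add (continuousOn_const.mul
      (Real.continuousOn_log.mono fun y hy => ?_)))
    exact ((Real.exp_pos _).trans_le hy.1).ne'
  have h := intermediate_value_Icc hle hcont
  have hleft : Eeps α ε (Real.exp (-α ^ 2 / (2 * ε))) = 0 := by
    rw [Eeps, Real.log_exp, mul_div_cancel₀ _ (by positivity)]
    ring
  have hright : Eeps α ε 1 = α ^ 2 := by simp [Eeps]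
  rwa [hleft, hright] at h

theorem EepsInv_mem {α ε t : ℝ} (hε : 0 < ε) (ht : t ∈ Set.Icc 0 (α ^ 2)) :
    EepsInv α ε t ∈ Set.Icc (Real.exp (-α ^ 2 / (2 * ε))) 1 :=
  Function.invFunOn_mem (surjOn_Eeps hε ht)

theorem Eeps_EepsInv {α ε t : ℝ} (hε : 0 < ε) (ht : t ∈ Set.Icc 0 (α ^ 2)) :
    Eeps α ε (EepsInv α ε t) = t :=
  Function.invFunOn_eq (surjOn_Eeps hε ht)

theorem EepsInv_pos {α ε t : ℝ} (hε : 0 < ε) (ht : t ∈ Set.Icc 0 (α ^ 2)) :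
    0 < EepsInv α ε t :=
  (Real.exp_pos _).trans_le (EepsInv_mem hε ht).1

theorem EepsInv_strictMonoOn {α ε : ℝ} (hε : 0 < ε) :
    StrictMonoOn (EepsInv α ε) (Set.Icc 0 (α ^ 2)) := by
  intro s hs t ht hst
  by_contra! hle
  have ht0 := EepsInv_pos hε ht
  have hlog := Real.log_le_log ht0 hle
  have hfac := Eeps_factor_nonneg hε (EepsInv_mem hε ht).1
  have : Eeps α ε (EepsInv α ε t) ≤ Eeps α ε (EepsInv α ε s) := by
    unfold Eeps
    gcongr
  rw [Eeps_EepsInv hε hs, Eeps_EepsInv hε ht] at this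
  exact this.not_gt hst

theorem mul_div_EepsInv_sq {α ε c x : ℝ} (hε : 0 < ε) (hx : c * x ^ 2 ∈ Set.Icc 0 (α ^ 2)) :
    c * (x / EepsInv α ε (c * x ^ 2)) ^ 2 =
      α ^ 2 + 2 * ε * Real.log (EepsInv α ε (c * x ^ 2)) := by
  have hpos := EepsInv_pos hε hx
  have h := Eeps_EepsInv hε hx
  rw [Eeps] at h
  rw [div_pow, ← mul_div_assoc, div_eq_iff (by positivity)]
  linarith

theorem div_EepsInv_lt_of_nonneg {α ε c a b : ℝ} (hε : 0 < ε) (hc : 0 < c) (ha : 0 ≤ a)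
    (hab : a < b) (hb : c * b ^ 2 ≤ α ^ 2) :
    a / EepsInv α ε (c * a ^ 2) < b / EepsInv α ε (c * b ^ 2) := by
  have hlt : c * a ^ 2 < c * b ^ 2 := by gcongr
  have hA : c * a ^ 2 ∈ Set.Icc 0 (α ^ 2) := ⟨by positivity, hlt.le.trans hb⟩
  have hB : c * b ^ 2 ∈ Set.Icc 0 (α ^ 2) := ⟨by positivity, hb⟩
  have hlog := Real.log_lt_log (EepsInv_pos hε hA) (EepsInv_strictMonoOn hε hA hB hlt)
  refine lt_of_pow_lt_pow_left₀ 2 (div_nonneg (ha.trans hab.le) (EepsInv_pos hε hB).le) ?_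
  refine lt_of_mul_lt_mul_left ?_ hc.le
  rw [mul_div_EepsInv_sq hε hA, mul_div_EepsInv_sq hε hB]
  gcongr

/-- For `α, ε, c > 0`, the function `h(x) = x / E_ε⁻¹(c x²)` is strictly
increasing on the set `{x : c x² ≤ α²}`. -/
theorem stmt_4 (α ε c : ℝ) (hα : 0 < α) (hε : 0 < ε) (hc : 0 < c) :
    StrictMonoOn (fun x : ℝ => x / EepsInv α ε (c * x ^ 2))
      {x : ℝ | c * x ^ 2 ≤ α ^ 2} := by
  intro a ha b hb hab
  simp only [Set.mem_ofPred_eq] at ha hb ⊢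
  rcases le_or_gt 0 a with ha0 | ha0
  · exact div_EepsInv_lt_of_nonneg hε hc ha0 hab hb
  rcases le_or_gt b 0 with hb0 | hb0
  · have h := div_EepsInv_lt_of_nonneg (α := α) hε hc (neg_nonneg.2 hb0) (neg_lt_neg hab)
      (by rwa [neg_sq])
    rwa [neg_sq, neg_sq, neg_div, neg_div, neg_lt_neg_iff] at h
  · exact (div_neg_of_neg_of_pos ha0 (EepsInv_pos hε ⟨by positivity, ha⟩)).trans
      (div_pos hb0 (EepsInv_pos hε ⟨by positivity, hb⟩))
end

section
/- Let ε > 0, α > 0, θ ∈ ℝⁿ with t := |θ|² satisfying 0 < t ≤ α², and let ζ ∈ (0, ε] be the unique solution of the dual algebraic equation εt = ζ²(2 ln(ζ/ε) + α²/ε). Then the infimum over γ ∈ ℝⁿ of (ε exp((|γ|² − α²)/(2ε)) − θ·γ) is attained at γ = εθ/ζ and equals ζ − εt/ζ = −(1/2)(εt/ζ + α²ζ/ε + 2ζ(ln(ζ/ε) − 1)). In particular the primal pointwise minimum value coincides with the dual pointwise maximum value (zero duality gap). -/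
open scoped RealInnerProductSpace

/-- Fenchel–Young inequality for `s ↦ ε * exp s`. -/
theorem mul_one_add_sub_log_le_mul_exp {ε ζ : ℝ} (hε : 0 < ε) (hζ : 0 < ζ) (s : ℝ) :
    ζ * (1 + s - Real.log (ζ / ε)) ≤ ε * Real.exp s := by
  have h := Real.add_one_le_exp (s - Real.log (ζ / ε))
  rw [Real.exp_sub, Real.exp_log (div_pos hζ hε)] at h
  calc ζ * (1 + s - Real.log (ζ / ε))
      ≤ ζ * (Real.exp s / (ζ / ε)) := by gcongr; linarith
    _ = ε * Real.exp s := by field_simp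

/-- Young's inequality for the inner product, with a positive weight `c`. -/
theorem real_inner_le_weighted_norm_sq {E : Type*} [NormedAddCommGroup E] [InnerProductSpace ℝ E]
    {c : ℝ} (hc : 0 < c) (x y : E) :
    ⟪x, y⟫ ≤ ‖x‖ ^ 2 / (2 * c) + c * ‖y‖ ^ 2 / 2 := by
  have h : 0 ≤ (‖x‖ - c * ‖y‖) ^ 2 / (2 * c) := by positivity
  have h' : (‖x‖ - c * ‖y‖) ^ 2 / (2 * c) =
      ‖x‖ ^ 2 / (2 * c) + c * ‖y‖ ^ 2 / 2 - ‖x‖ * ‖y‖ := by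
    field_simp
    ring
  linarith [real_inner_le_norm x y]

/-- Weak duality: every value of the complementary energy is a lower bound for the primal energy. -/
theorem complementary_energy_le_primal_energy {E : Type*} [NormedAddCommGroup E]
    [InnerProductSpace ℝ E] {ε ζ : ℝ} (hε : 0 < ε) (hζ : 0 < ζ) (α : ℝ) (θ γ : E) :
    -(1 / 2) * (ε * ‖θ‖ ^ 2 / ζ + α ^ 2 * ζ / ε + 2 * ζ * (Real.log (ζ / ε) - 1)) ≤
      ε * Real.exp ((‖γ‖ ^ 2 - α ^ 2) / (2 * ε)) - ⟪θ, γ⟫ := by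
  have h₁ := mul_one_add_sub_log_le_mul_exp hε hζ ((‖γ‖ ^ 2 - α ^ 2) / (2 * ε))
  have h₂ := real_inner_le_weighted_norm_sq (div_pos hζ hε) θ γ
  have h₃ : -(1 / 2) * (ε * ‖θ‖ ^ 2 / ζ + α ^ 2 * ζ / ε + 2 * ζ * (Real.log (ζ / ε) - 1)) =
      ζ * (1 + (‖γ‖ ^ 2 - α ^ 2) / (2 * ε) - Real.log (ζ / ε)) -
        (‖θ‖ ^ 2 / (2 * (ζ / ε)) + ζ / ε * ‖γ‖ ^ 2 / 2) := by
    field_simp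
    ring
  linarith

/-- Pointwise perfect duality: if `t = |θ|²` with `0 < t ≤ α²` and
`ζ ∈ (0, ε]` solves the dual algebraic equation
`εt = ζ²(2 ln(ζ/ε) + α²/ε)`, then the infimum over `γ` of
`ε exp((|γ|²−α²)/(2ε)) − θ·γ` is attained at `γ = (ε/ζ)θ` and equals
`ζ − εt/ζ = −(1/2)(εt/ζ + α²ζ/ε + 2ζ(ln(ζ/ε) − 1))`. -/
theorem stmt_13 (n : ℕ) (hn : 1 ≤ n) (ε α : ℝ) (hε : 0 < ε) (hα : 0 < α)
    (θ : EuclideanSpace ℝ (Fin n)) (t : ℝ) (ht : t = ‖θ‖ ^ 2)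
    (ht0 : 0 < t) (htα : t ≤ α ^ 2)
    (ζ : ℝ) (hζ0 : 0 < ζ) (hζε : ζ ≤ ε)
    (hDAE : ε * t = ζ ^ 2 * (2 * Real.log (ζ / ε) + α ^ 2 / ε)) :
    IsLeast
      (Set.range fun γ : EuclideanSpace ℝ (Fin n) =>
        ε * Real.exp ((‖γ‖ ^ 2 - α ^ 2) / (2 * ε)) - ⟪θ, γ⟫)
      (ζ - ε * t / ζ) ∧
    ε * Real.exp ((‖(ε / ζ) • θ‖ ^ 2 - α ^ 2) / (2 * ε)) - ⟪θ, (ε / ζ) • θ⟫ =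
      ζ - ε * t / ζ ∧
    ζ - ε * t / ζ =
      -(1 / 2) * (ε * t / ζ + α ^ 2 * ζ / ε + 2 * ζ * (Real.log (ζ / ε) - 1)) := by
  have hdual : ζ - ε * t / ζ =
      -(1 / 2) * (ε * t / ζ + α ^ 2 * ζ / ε + 2 * ζ * (Real.log (ζ / ε) - 1)) := by
    rw [hDAE]
    field_simp
    ring
  have hexp : (‖(ε / ζ) • θ‖ ^ 2 - α ^ 2) / (2 * ε) = Real.log (ζ / ε) := by
    have hnorm : ‖(ε / ζ) • θ‖ ^ 2 = ε * (ε * t) / ζ ^ 2 := by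
      rw [norm_smul, mul_pow, Real.norm_eq_abs, sq_abs, ht]
      ring
    rw [hnorm, hDAE]
    field_simp
    ring
  have hprimal : ε * Real.exp ((‖(ε / ζ) • θ‖ ^ 2 - α ^ 2) / (2 * ε)) - ⟪θ, (ε / ζ) • θ⟫ =
      ζ - ε * t / ζ := by
    rw [hexp, Real.exp_log (div_pos hζ0 hε), real_inner_smul_right, real_inner_self_eq_norm_sq,
      ← ht]
    field_simp
  refine ⟨⟨⟨(ε / ζ) • θ, hprimal⟩, ?_⟩, hprimal, hdual⟩
  rintro _ ⟨γ, rfl⟩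
  rw [hdual, ht]
  exact complementary_energy_le_primal_energy hε hζ0 α θ γ
end

section
/- Let ε > 0 and α > 0. For every t ∈ [0, α²] there exists a unique ζ in the interval [ε·exp(−α²/(2ε)), ε] satisfying the dual algebraic equation εt = ζ²(2 ln(ζ/ε) + α²/ε). (Equivalently, writing λ = ζ/ε, the equation becomes E_ε(λ) = t with λ ∈ [exp(−α²/(2ε)), 1].) -/
/-- The map `ζ ↦ ζ²(2 ln(ζ/ε) + c)` is strictly increasing from the point `ε·exp(−c/2)`,
where it vanishes, onwards. -/
theorem strictMonoOn_sq_mul_log_div_add {ε : ℝ} (hε : 0 < ε) (c : ℝ) :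
    StrictMonoOn (fun ζ : ℝ => ζ ^ 2 * (2 * Real.log (ζ / ε) + c))
      (Set.Ici (ε * Real.exp (-c / 2))) := by
  intro x hx y _ hxy
  have hx' : Real.exp (-c / 2) ≤ x / ε := by
    rw [le_div_iff₀ hε, mul_comm]
    exact hx
  have hx0 : 0 < x := (mul_pos hε (Real.exp_pos _)).trans_le hx
  have hlog : -c / 2 ≤ Real.log (x / ε) := (Real.le_log_iff_exp_le (div_pos hx0 hε)).2 hx'
  have hlt : Real.log (x / ε) < Real.log (y / ε) :=
    Real.log_lt_log (div_pos hx0 hε) (div_lt_div_of_pos_right hxy hε)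
  have hsq : x ^ 2 < y ^ 2 := pow_lt_pow_left₀ hxy hx0.le two_ne_zero
  exact mul_lt_mul' hsq.le (by linarith) (by linarith) (pow_pos (hx0.trans hxy) 2)

/-- For every `t ∈ [0, α²]` the dual algebraic equation
`εt = ζ²(2 ln(ζ/ε) + α²/ε)` has a unique solution
`ζ ∈ [ε·exp(−α²/(2ε)), ε]`. -/
theorem stmt_14 (ε α : ℝ) (hε : 0 < ε) (hα : 0 < α) :
    ∀ t ∈ Set.Icc (0 : ℝ) (α ^ 2),
      ∃! ζ : ℝ, ζ ∈ Set.Icc (ε * Real.exp (-α ^ 2 / (2 * ε))) ε ∧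
        ε * t = ζ ^ 2 * (2 * Real.log (ζ / ε) + α ^ 2 / ε) := by
  rintro t ⟨ht0, ht1⟩
  have hexp : -α ^ 2 / (2 * ε) = -(α ^ 2 / ε) / 2 := by
    field_simp
  rw [hexp]
  have hmono := strictMonoOn_sq_mul_log_div_add hε (α ^ 2 / ε)
  set f : ℝ → ℝ := fun ζ => ζ ^ 2 * (2 * Real.log (ζ / ε) + α ^ 2 / ε) with hf
  set a : ℝ := ε * Real.exp (-(α ^ 2 / ε) / 2) with ha
  have ha0 : 0 < a := mul_pos hε (Real.exp_pos _)
  have hle : a ≤ ε := by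
    refine mul_le_of_le_one_right hε.le (Real.exp_le_one_iff.2 ?_)
    have : 0 ≤ α ^ 2 / ε := by positivity
    linarith
  have hfa : f a = 0 := by
    simp only [hf, ha]
    rw [mul_div_cancel_left₀ _ hε.ne', Real.log_exp]
    ring
  have hfε : f ε = ε * α ^ 2 := by
    simp only [hf]
    rw [div_self hε.ne', Real.log_one]
    field_simp
    ring
  have hcont : ContinuousOn f (Set.Icc a ε) := by
    refine (continuousOn_id.pow 2).mul ((continuousOn_const.mul
      (ContinuousOn.log (continuousOn_id.div_const ε) ?_)).add continuousOn_const)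
    intro x hx
    exact (div_pos (ha0.trans_le hx.1) hε).ne'
  have hmem : ε * t ∈ Set.Icc (f a) (f ε) := by
    rw [hfa, hfε]
    exact ⟨mul_nonneg hε.le ht0, mul_le_mul_of_nonneg_left ht1 hε.le⟩
  obtain ⟨ζ, hζ, hζt⟩ := intermediate_value_Icc hle hcont hmem
  refine ⟨ζ, ⟨hζ, hζt.symm⟩, ?_⟩
  rintro y ⟨hy, hyt⟩
  exact hmono.injOn hy.1 hζ.1 (hyt.symm.trans hζt.symm)
end
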